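/- arXiv:1801.08919 — 7 statements merged into one kernel-verified Lean document; each statement's English description precedes it below -/
import Mathlib

section
/- For every natural number n ≥ 1 and every odd integer r > 1, there exists an r-colouring c : [3]^n → ZMod r such that there is no monochromatic combinatorial line (with respect to c) whose wildcard set S can be written as a union of fewer than r intervals of [n]. -/
/- A word over the alphabet `[m]` of length `n` is a function `Fin n → Fin m`
(letter `k` of `[m]` corresponds to index `k - 1`).
`updSet w S i` is the word `w(S, i)` obtained from `w` by replacing the `j`-th letter
with `i` for all `j ∈ S`. -/
open Classical in
noncomputable def updSet {n m : ℕ} (w : Fin n → Fin m) (S : Set (Fin n)) (i : Fin m) :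
    Fin n → Fin m := fun j => if j ∈ S then i else w j

/-- `S ⊆ [n]` is the union of `q` intervals. -/
def UnionOfIntervals {n : ℕ} (q : ℕ) (S : Set (Fin n)) : Prop :=
  ∃ I : Fin q → Fin n × Fin n, S = ⋃ k, Set.Icc (I k).1 (I k).2

/-- The letter weights `-1, 1, 0` extended to positions `ℕ`: position `j + 1` carries the
weight of the `j`-th letter of `w`, and all positions outside the word carry weight `0`. -/
def paddedWeight {n : ℕ} (r : ℕ) (w : Fin n → Fin 3) : ℕ → ZMod r
  | 0 => 0
  | j + 1 => if h : j < n then ![-1, 1, 0] (w ⟨j, h⟩) else 0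

/-- The sum of the squared jumps of the weights along a word. -/
def jumpEnergy {n : ℕ} (r : ℕ) (w : Fin n → Fin 3) : ZMod r :=
  ∑ j ∈ Finset.range (n + 1), (paddedWeight r w (j + 1) - paddedWeight r w j) ^ 2

/-- The set of positions `j + 1` with `j ∈ S`. -/
def shiftedSet {n : ℕ} (S : Set (Fin n)) : Set ℕ := {k | ∃ j ∈ S, (j : ℕ) + 1 = k}

lemma succ_mem_shiftedSet {n : ℕ} {S : Set (Fin n)} {j : ℕ} :
    j + 1 ∈ shiftedSet S ↔ ∃ h : j < n, ⟨j, h⟩ ∈ S := by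
  constructor
  · rintro ⟨i, hi, hij⟩
    obtain rfl : (i : ℕ) = j := by omega
    exact ⟨i.2, hi⟩
  · rintro ⟨h, hj⟩
    exact ⟨_, hj, rfl⟩

lemma zero_notMem_shiftedSet {n : ℕ} (S : Set (Fin n)) : 0 ∉ shiftedSet S := by
  rintro ⟨i, _, hi⟩
  omega

lemma succ_length_notMem_shiftedSet {n : ℕ} (S : Set (Fin n)) : n + 1 ∉ shiftedSet S := by
  rw [succ_mem_shiftedSet]
  rintro ⟨h, _⟩
  omega

open Classical in
lemma paddedWeight_updSet {n r : ℕ} (w : Fin n → Fin 3) (S : Set (Fin n)) (i : Fin 3) (k : ℕ) :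
    paddedWeight r (updSet w S i) k =
      if k ∈ shiftedSet S then ![-1, 1, 0] i else paddedWeight r w k := by
  cases k with
  | zero => simp [zero_notMem_shiftedSet, paddedWeight]
  | succ j =>
    by_cases h : j < n
    · by_cases hj : (⟨j, h⟩ : Fin n) ∈ S <;>
        simp [succ_mem_shiftedSet, paddedWeight, updSet, h, hj]
    · simp [succ_mem_shiftedSet, paddedWeight, h]

open Classical in
/-- The positions below `m` immediately preceding a maximal run of `T`. -/
noncomputable def runStarts (T : Set ℕ) (m : ℕ) : Finset ℕ :=
  {j ∈ Finset.range m | j ∉ T ∧ j + 1 ∈ T}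

open Classical in
/-- The positions below `m` which are the last of a maximal run of `T`. -/
noncomputable def runEnds (T : Set ℕ) (m : ℕ) : Finset ℕ :=
  {j ∈ Finset.range m | j ∈ T ∧ j + 1 ∉ T}

open Classical in
lemma card_runStarts_eq_card_runEnds {T : Set ℕ} {m : ℕ} (h0 : 0 ∉ T) (hm : m ∉ T) :
    (runStarts T m).card = (runEnds T m).card := by
  have key : ∀ k, (runStarts T k).card = (runEnds T k).card + if k ∈ T then 1 else 0 := by
    intro k
    induction k with
    | zero => simp [runStarts, runEnds, h0]
    | succ k ih =>
      simp only [runStarts, runEnds, Finset.card_filter, Finset.sum_range_succ] at ih ⊢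
      rw [ih]
      by_cases h1 : k ∈ T <;> by_cases h2 : k + 1 ∈ T <;> simp [h1, h2]
  simpa [hm] using key m

lemma jumpEnergy_second_difference {n r : ℕ} (w : Fin n → Fin 3) (S : Set (Fin n)) :
    jumpEnergy r (updSet w S 0) + jumpEnergy r (updSet w S 1) - 2 * jumpEnergy r (updSet w S 2) =
      4 * ((runStarts (shiftedSet S) (n + 1)).card : ZMod r) := by
  classical
  have h : (4 : ZMod r) * ((runStarts (shiftedSet S) (n + 1)).card : ZMod r) =
      2 * ((runStarts (shiftedSet S) (n + 1)).card : ZMod r) +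
        2 * ((runEnds (shiftedSet S) (n + 1)).card : ZMod r) := by
    rw [card_runStarts_eq_card_runEnds (zero_notMem_shiftedSet S) (succ_length_notMem_shiftedSet S)]
    ring
  rw [h]
  simp only [jumpEnergy, runStarts, runEnds, Finset.card_filter, Nat.cast_sum, Finset.mul_sum,
    ← Finset.sum_add_distrib, ← Finset.sum_sub_distrib]
  refine Finset.sum_congr rfl fun j _ => ?_
  simp only [paddedWeight_updSet]
  by_cases h1 : j ∈ shiftedSet S <;> by_cases h2 : j + 1 ∈ shiftedSet S <;> simp [h1, h2] <;> ring

lemma card_runStarts_pos {n : ℕ} {S : Set (Fin n)} (hS : S.Nonempty) :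
    0 < (runStarts (shiftedSet S) (n + 1)).card := by
  classical
  have hne : ∃ k, k + 1 ∈ shiftedSet S := by
    obtain ⟨i, hi⟩ := hS
    exact ⟨i, i, hi, rfl⟩
  have hspec := Nat.find_spec hne
  obtain ⟨hlt, -⟩ := succ_mem_shiftedSet.1 hspec
  refine Finset.card_pos.2 ⟨Nat.find hne, ?_⟩
  simp only [runStarts, Finset.mem_filter, Finset.mem_range]
  refine ⟨by omega, ?_, hspec⟩
  rcases hk : Nat.find hne with _ | k
  · exact zero_notMem_shiftedSet S
  · exact Nat.find_min hne (by omega)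

lemma card_runStarts_le {n q : ℕ} {S : Set (Fin n)} (hS : UnionOfIntervals q S) :
    (runStarts (shiftedSet S) (n + 1)).card ≤ q := by
  classical
  obtain ⟨I, rfl⟩ := hS
  have hsub : runStarts (shiftedSet (⋃ k, Set.Icc (I k).1 (I k).2)) (n + 1) ⊆
      Finset.univ.image fun k => ((I k).1 : ℕ) := by
    intro j hj
    simp only [runStarts, Finset.mem_filter, Finset.mem_range] at hj
    obtain ⟨-, hnot, hmem⟩ := hj
    obtain ⟨hlt, hj⟩ := succ_mem_shiftedSet.1 hmem
    obtain ⟨k, hk1, hk2⟩ := Set.mem_iUnion.1 hj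
    simp only [Finset.mem_image, Finset.mem_univ, true_and]
    refine ⟨k, ?_⟩
    by_contra hne
    rw [Fin.le_def] at hk1 hk2
    dsimp only at hk1 hk2
    obtain ⟨i, rfl⟩ : ∃ i, j = i + 1 := ⟨j - 1, by omega⟩
    exact hnot (succ_mem_shiftedSet.2 ⟨by omega, Set.mem_iUnion.2
      ⟨k, Fin.le_def.2 (by dsimp only; omega), Fin.le_def.2 (by dsimp only; omega)⟩⟩)
  calc _ ≤ _ := Finset.card_le_card hsub
    _ ≤ _ := Finset.card_image_le
    _ = q := by simp

/-- For every `n ≥ 1` and every odd `r > 1` there is an `r`-colouring of `[3]^n`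
containing no monochromatic combinatorial line whose wildcard set is the union of
fewer than `r` intervals. -/
theorem stmt0 (n r : ℕ) (hn : 1 ≤ n) (hr : 1 < r) (hodd : Odd r) :
    ∃ c : (Fin n → Fin 3) → ZMod r,
      ¬ ∃ (w : Fin n → Fin 3) (S : Set (Fin n)) (q : ℕ),
        S.Nonempty ∧ q < r ∧ UnionOfIntervals q S ∧
        ∀ i j : Fin 3, c (updSet w S i) = c (updSet w S j) := by
  refine ⟨jumpEnergy r, ?_⟩
  rintro ⟨w, S, q, hS, hqr, hq, hc⟩
  have h := jumpEnergy_second_difference (r := r) w S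
  rw [hc 0 2, hc 1 2, ← two_mul, sub_self] at h
  have hdvd : r ∣ 4 * (runStarts (shiftedSet S) (n + 1)).card := by
    rw [← ZMod.natCast_eq_zero_iff]
    push_cast
    exact h.symm
  have hcop : Nat.Coprime r 4 := Nat.Coprime.pow_right 2 hodd.coprime_two_right
  have hle := Nat.le_of_dvd (card_runStarts_pos hS) (hcop.dvd_of_dvd_mul_left hdvd)
  exact absurd (hle.trans (card_runStarts_le hq)) (not_le.2 hqr)
end

section
/- Fix an odd integer r > 1 and weights t₁ = t₃ = 2, t₂ = −1 in ZMod r. Then for every n ≥ 1, the colouring T⁺ : [3]^n → ZMod r contains no monochromatic combinatorial line whose wildcard set is the union of fewer than r intervals of [n]. -/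
/-- `T(w)` for a word given as a list: sum of the weights `t` over the contraction of
the word, where the contraction replaces each maximal run of equal consecutive letters
by a single letter (`List.destutter (· ≠ ·)`). -/
def Tword {r : ℕ} (t : Fin 3 → ZMod r) (l : List (Fin 3)) : ZMod r :=
  ((l.destutter (· ≠ ·)).map t).sum

/-- `T⁺(w) = T(w⁺)`, where `w⁺` is `w` with the letter `1` (index `0`) inserted at the
start and at the end. -/
def Tplus {n r : ℕ} (t : Fin 3 → ZMod r) (w : Fin n → Fin 3) : ZMod r :=
  Tword t ((0 : Fin 3) :: (List.ofFn w ++ [(0 : Fin 3)]))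

/-- The weight of `w` splits off its first letter, unless that letter is repeated. -/
theorem Tword_cons_cons {r : ℕ} (t : Fin 3 → ZMod r) (a b : Fin 3) (l : List (Fin 3)) :
    Tword t (a :: b :: l) = (if a ≠ b then t a else 0) + Tword t (b :: l) := by
  by_cases h : a = b
  · subst h
    simp [Tword, List.destutter, List.destutter']
  · simp [Tword, List.destutter, List.destutter', h]

/-- The second difference, in the letter substituted for the wildcard `none`,
of the weight of a word with wildcards. -/
def secondDiff (r : ℕ) (l : List (Option (Fin 3))) : ZMod r :=
  Tword ![2, -1, 2] (l.map (·.getD 0)) - 2 * Tword ![2, -1, 2] (l.map (·.getD 1))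
    + Tword ![2, -1, 2] (l.map (·.getD 2))

/-- The number of positions at which a block of wildcards starts, in a word `f`
preceded by the letter `o`. -/
def blockStarts {n : ℕ} (o : Option (Fin 3)) (f : Fin n → Option (Fin 3)) : Finset (Fin n) :=
  {j | f j = none ∧ (Fin.cons o f : Fin (n + 1) → Option (Fin 3)) j.castSucc ≠ none}

theorem card_blockStarts_succ {n : ℕ} (o : Option (Fin 3)) (f : Fin (n + 1) → Option (Fin 3)) :
    (blockStarts o f).card =
      (if f 0 = none ∧ o ≠ none then 1 else 0) +
        (blockStarts (f 0) (fun j => f j.succ)).card := by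
  simp only [blockStarts, Finset.card_filter, Fin.sum_univ_succ]
  congr 1
  refine Finset.sum_congr rfl fun j _ => ?_
  congr! 3
  obtain ⟨_ | k, hk⟩ := j <;> rfl

theorem secondDiff_cons_cons (r : ℕ) (o p : Option (Fin 3)) (l : List (Option (Fin 3))) :
    secondDiff r (o :: p :: l) + (if o = none then 0 else 4) + (if p = none then 4 else 0) =
      secondDiff r (p :: l) + 4 + 2 * (if p = none ∧ o ≠ none then 1 else 0) := by
  simp only [secondDiff, List.map_cons, Tword_cons_cons]
  rcases o with _ | a <;> rcases p with _ | b
  · simp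
  · fin_cases b <;> simp <;> ring
  · fin_cases a <;> simp <;> ring
  · by_cases h : a = b <;> simp [h] <;> ring

theorem secondDiff_ofFn (r : ℕ) {n : ℕ} (o : Option (Fin 3)) (f : Fin n → Option (Fin 3))
    (c : Fin 3) :
    secondDiff r (o :: (List.ofFn f ++ [some c])) =
      (if o = none then 4 else 0) + 2 * ((blockStarts o f).card : ZMod r) := by
  induction n generalizing o with
  | zero =>
    have h := secondDiff_cons_cons r o (some c) []
    have h1 : secondDiff r [some c] = 0 := by
      simp [secondDiff]; ring
    have h2 : blockStarts o f = ∅ := Finset.eq_empty_of_isEmpty _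
    simp only [List.ofFn_zero, List.nil_append, h2]
    rw [h1] at h
    split_ifs at h ⊢ <;> simp_all
  | succ n ih =>
    have h := secondDiff_cons_cons r o (f 0) (List.ofFn (fun j => f j.succ) ++ [some c])
    rw [ih] at h
    rw [List.ofFn_succ, List.cons_append, card_blockStarts_succ]
    push_cast
    split_ifs at h ⊢ <;> linear_combination h

/-- The word `w` with the letters in `S` replaced by wildcards. -/
noncomputable def wildcardWord {n : ℕ} (w : Fin n → Fin 3) (S : Set (Fin n)) :
    Fin n → Option (Fin 3) :=
  open Classical in fun j => if j ∈ S then none else some (w j)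

theorem wildcardWord_eq_none {n : ℕ} {w : Fin n → Fin 3} {S : Set (Fin n)} {j : Fin n} :
    wildcardWord w S j = none ↔ j ∈ S := by
  simp [wildcardWord]

theorem Tplus_updSet {n r : ℕ} (t : Fin 3 → ZMod r) (w : Fin n → Fin 3) (S : Set (Fin n))
    (i : Fin 3) :
    Tplus t (updSet w S i) =
      Tword t ((some 0 :: (List.ofFn (wildcardWord w S) ++ [some 0])).map (·.getD i)) := by
  have h : updSet w S i = fun j => (wildcardWord w S j).getD i := by
    funext j
    by_cases hj : j ∈ S <;> simp [updSet, wildcardWord, hj]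
  simp [Tplus, h, List.map_ofFn, Function.comp_def]

theorem mem_blockStarts_wildcardWord {n : ℕ} {w : Fin n → Fin 3} {S : Set (Fin n)} {c : Fin 3}
    {j : Fin n} :
    j ∈ blockStarts (some c) (wildcardWord w S) ↔
      j ∈ S ∧ ∀ i : Fin n, (i : ℕ) + 1 = j → i ∉ S := by
  simp only [blockStarts, Finset.mem_filter, Finset.mem_univ, true_and, wildcardWord_eq_none]
  refine and_congr_right fun _ => ?_
  obtain ⟨j, hj⟩ := j
  cases j with
  | zero => exact iff_of_true (by simp) (fun i hi => by simp at hi)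
  | succ k =>
    have : (Fin.cons (some c) (wildcardWord w S) : Fin (n + 1) → Option (Fin 3))
        (Fin.castSucc ⟨k + 1, hj⟩) = wildcardWord w S ⟨k, by omega⟩ := rfl
    rw [this, Ne, wildcardWord_eq_none]
    refine ⟨fun h i hi => ?_, fun h => h _ rfl⟩
    have hik : i = ⟨k, by omega⟩ := Fin.ext (by simpa using hi)
    rwa [hik]

theorem card_blockStarts_le {n q : ℕ} {w : Fin n → Fin 3} {S : Set (Fin n)} {c : Fin 3}
    (hS : UnionOfIntervals q S) : (blockStarts (some c) (wildcardWord w S)).card ≤ q := by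
  obtain ⟨I, rfl⟩ := hS
  calc _ ≤ (Finset.univ.image fun k => (I k).1).card := by
        refine Finset.card_le_card fun j hj => ?_
        obtain ⟨hj, hpred⟩ := mem_blockStarts_wildcardWord.1 hj
        obtain ⟨k, hk⟩ := Set.mem_iUnion.1 hj
        refine Finset.mem_image.2 ⟨k, Finset.mem_univ _, hk.1.eq_of_not_lt fun hlt => ?_⟩
        have hlt' : ((I k).1 : ℕ) < j := hlt
        have hle : (j : ℕ) ≤ (I k).2 := hk.2
        refine hpred ⟨j - 1, by omega⟩ (by simp; omega) (Set.mem_iUnion.2 ⟨k, ?_, ?_⟩) <;>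
          simp only [Fin.le_def] <;> omega
    _ ≤ q := Finset.card_image_le.trans (by simp)

theorem blockStarts_nonempty {n : ℕ} {w : Fin n → Fin 3} {S : Set (Fin n)} {c : Fin 3}
    (hS : S.Nonempty) : (blockStarts (some c) (wildcardWord w S)).Nonempty := by
  obtain ⟨j, hj, hmin⟩ := S.exists_min_image id S.toFinite hS
  refine ⟨j, mem_blockStarts_wildcardWord.2 ⟨hj, fun i hi hiS => ?_⟩⟩
  have : (j : ℕ) ≤ i := hmin i hiS
  omega

/-- With weights `t₁ = t₃ = 2`, `t₂ = -1` in `ZMod r` (`r > 1` odd), the colouring `T⁺`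
of `[3]^n` contains no monochromatic combinatorial line whose wildcard set is the union
of fewer than `r` intervals. -/
theorem stmt1 (n r : ℕ) (hn : 1 ≤ n) (hr : 1 < r) (hodd : Odd r) :
    ¬ ∃ (w : Fin n → Fin 3) (S : Set (Fin n)) (q : ℕ),
      S.Nonempty ∧ q < r ∧ UnionOfIntervals q S ∧
      ∀ i j : Fin 3,
        Tplus (![2, -1, 2] : Fin 3 → ZMod r) (updSet w S i) =
        Tplus (![2, -1, 2] : Fin 3 → ZMod r) (updSet w S j) := by
  rintro ⟨w, S, q, hne, hq, hS, hmono⟩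
  have h := secondDiff_ofFn r (some 0) (wildcardWord w S) 0
  simp only [secondDiff, ← Tplus_updSet, hmono 1 0, hmono 2 0] at h
  set m := (blockStarts (some 0) (wildcardWord w S)).card
  have h0 : ((2 * m : ℕ) : ZMod r) = 0 := by
    push_cast
    simp only [reduceCtorEq, if_false] at h
    linear_combination -h
  have hdvd : r ∣ m :=
    (Nat.coprime_two_right.2 hodd).dvd_of_dvd_mul_left ((ZMod.natCast_eq_zero_iff _ _).1 h0)
  have hpos : 0 < m := Finset.card_pos.2 (blockStarts_nonempty hne)
  exact absurd (Nat.le_of_dvd hpos hdvd) (not_le.2 ((card_blockStarts_le hS).trans_lt hq))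
end

section
/- Fix weights t₁ = t₃ = 2 and t₂ = −1 in ZMod r. Let (x₁, x₂, x₃) be a combinatorial line in [3]^n with x_i = w(S,i), where S is the union of q pairwise disjoint, pairwise non-adjacent intervals of [n]. Then T⁺(x₁) + T⁺(x₃) − 2·T⁺(x₂) = 2q in ZMod r. In particular, if the line is monochromatic under T⁺ (i.e. T⁺(x₁) = T⁺(x₂) = T⁺(x₃)), then 2q = 0 in ZMod r. -/
/-- The weight contributed by a letter `b` preceded by the letter `a` in a word. -/
def stepWeight {r : ℕ} (t : Fin 3 → ZMod r) (a b : Fin 3) : ZMod r := if a ≠ b then t b else 0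

theorem Tword_map_range {r : ℕ} (t : Fin 3 → ZMod r) (m : ℕ) (W : ℕ → Fin 3) :
    Tword t ((List.range (m + 1)).map W) =
      t (W 0) + ∑ j ∈ Finset.range m, stepWeight t (W j) (W (j + 1)) := by
  induction m generalizing W with
  | zero => simp [Tword]
  | succ m ih =>
    have ih' := ih (fun j => W (j + 1))
    rw [Finset.sum_range_succ', List.range_succ_eq_map]
    rw [List.range_succ_eq_map] at ih' ⊢
    simp only [Tword, List.map_cons, List.map_map, List.destutter_cons'] at ih' ⊢
    by_cases h : W 0 = W 1
    · simp only [Nat.succ_eq_add_one, zero_add, h, stepWeight, Function.comp_def] at ih' ⊢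
      simpa using ih'
    · simp only [Nat.succ_eq_add_one, zero_add, stepWeight, Function.comp_def] at ih' ⊢
      rw [List.destutter'_cons_pos _ h, List.map_cons, List.sum_cons, ih', if_pos h]
      ring

/-- The word `w⁺` read as a sequence, continued by the letter `0`. -/
def padWord {n : ℕ} (w : Fin n → Fin 3) : ℕ → Fin 3
  | 0 => 0
  | j + 1 => if h : j < n then w ⟨j, h⟩ else 0

theorem Tplus_eq_sum {n r : ℕ} (t : Fin 3 → ZMod r) (w : Fin n → Fin 3) :
    Tplus t w = t 0 +
      ∑ j ∈ Finset.range (n + 1), stepWeight t (padWord w j) (padWord w (j + 1)) := by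
  have h : (0 : Fin 3) :: (List.ofFn w ++ [(0 : Fin 3)]) =
      (List.range (n + 1 + 1)).map (padWord w) := by
    apply List.ext_getElem
    · simp
    · intro j h₁ h₂
      cases j with
      | zero => simp [padWord]
      | succ j =>
        simp [padWord, List.getElem_append]
  rw [Tplus, h, Tword_map_range]
  rfl

theorem stepWeight_combination {r : ℕ} (p p' : Prop) [Decidable p] [Decidable p'] (u v : Fin 3) :
    stepWeight (![2, -1, 2] : Fin 3 → ZMod r) (if p then 0 else u) (if p' then 0 else v) +
        stepWeight (![2, -1, 2] : Fin 3 → ZMod r) (if p then 2 else u) (if p' then 2 else v) -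
        2 * stepWeight (![2, -1, 2] : Fin 3 → ZMod r) (if p then 1 else u) (if p' then 1 else v) =
      2 * (if ¬p ∧ p' then 1 else 0) +
        2 * ((if p' then 1 else 0) - (if p then 1 else 0)) := by
  by_cases hp : p <;> by_cases hp' : p' <;>
    simp only [hp, hp', if_true, if_false, not_true, not_false_eq_true, and_true, and_false]
  · simp [stepWeight]
  · fin_cases v <;> simp [stepWeight] <;> ring
  · fin_cases u <;> simp [stepWeight]
  · ring

theorem card_starts_of_separated {n q : ℕ} (a b : Fin q → Fin n) (hab : ∀ k, a k ≤ b k)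
    (hsep : ∀ k l, k ≠ l → (b k : ℕ) + 1 < (a l : ℕ) ∨ (b l : ℕ) + 1 < (a k : ℕ))
    (P : ℕ → Prop) [DecidablePred P] (hP : ∀ j, P j ↔ ∃ k, (a k : ℕ) < j ∧ j ≤ (b k : ℕ) + 1) :
    ((Finset.range (n + 1)).filter (fun j => ¬P j ∧ P (j + 1))).card = q := by
  have hab' : ∀ k, (a k : ℕ) ≤ b k := hab
  have hinj : Function.Injective (fun k => (a k : ℕ)) := by
    intro k l hkl
    by_contra hne
    have := hsep k l hne
    have := hab' k
    have := hab' l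
    simp only at hkl
    omega
  have himage : (Finset.range (n + 1)).filter (fun j => ¬P j ∧ P (j + 1)) =
      Finset.univ.image (fun k => (a k : ℕ)) := by
    ext j
    simp only [Finset.mem_filter, Finset.mem_range, Finset.mem_image, Finset.mem_univ, true_and]
    constructor
    · rintro ⟨-, h, h'⟩
      obtain ⟨k, hk, hk'⟩ := (hP _).1 h'
      refine ⟨k, ?_⟩
      by_contra hne
      exact h ((hP _).2 ⟨k, by omega, by omega⟩)
    · rintro ⟨k, rfl⟩
      refine ⟨by omega, fun h => ?_, (hP _).2 ⟨k, by omega, by have := hab' k; omega⟩⟩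
      obtain ⟨l, hl, hl'⟩ := (hP _).1 h
      have hne : k ≠ l := by
        rintro rfl
        omega
      have := hsep k l hne
      have := hab' k
      omega
  rw [himage, Finset.card_image_of_injective _ hinj, Finset.card_univ, Fintype.card_fin]

/-- With weights `t₁ = t₃ = 2`, `t₂ = -1` in `ZMod r`: if `(x₁, x₂, x₃)` is a
combinatorial line with `x_i = w(S, i)` and `S` is the union of `q` pairwise disjoint,
pairwise non-adjacent nonempty intervals `[a k, b k]` (disjointness and non-adjacency
of the `k`-th and `l`-th intervals being expressed by a gap of at least one letter
between them), then `T⁺(x₁) + T⁺(x₃) - 2 T⁺(x₂) = 2q`, and in particular if the line is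
monochromatic under `T⁺` then `2q = 0` in `ZMod r`. -/
theorem stmt4 (r n q : ℕ) (w : Fin n → Fin 3) (a b : Fin q → Fin n)
    (hab : ∀ k, a k ≤ b k)
    (hsep : ∀ k l, k ≠ l → (b k : ℕ) + 1 < (a l : ℕ) ∨ (b l : ℕ) + 1 < (a k : ℕ))
    (S : Set (Fin n)) (hS : S = ⋃ k, Set.Icc (a k) (b k)) :
    Tplus (![2, -1, 2] : Fin 3 → ZMod r) (updSet w S 0) +
          Tplus (![2, -1, 2] : Fin 3 → ZMod r) (updSet w S 2) -
        2 * Tplus (![2, -1, 2] : Fin 3 → ZMod r) (updSet w S 1) = 2 * (q : ZMod r) ∧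
      ((∀ i j : Fin 3,
          Tplus (![2, -1, 2] : Fin 3 → ZMod r) (updSet w S i) =
          Tplus (![2, -1, 2] : Fin 3 → ZMod r) (updSet w S j)) →
        2 * (q : ZMod r) = 0) := by
  classical
  set P : ℕ → Prop := fun j => ∃ k, (a k : ℕ) < j ∧ j ≤ (b k : ℕ) + 1 with hPdef
  have hpad : ∀ i j, padWord (updSet w S i) j = if P j then i else padWord w j := by
    intro i j
    cases j with
    | zero => simp [padWord, P]
    | succ j =>
      by_cases hj : j < n
      · have hmem : (⟨j, hj⟩ : Fin n) ∈ S ↔ P (j + 1) := by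
          simp only [hS, Set.mem_iUnion, Set.mem_Icc, Fin.le_def, P, Nat.lt_succ_iff,
            Nat.succ_le_succ_iff]
        simp only [padWord, updSet, hj, dif_pos, hmem]
      · have hnot : ¬P (j + 1) := by
          rintro ⟨k, -, hk⟩
          have := (b k).isLt
          omega
        simp [padWord, hj, hnot]
  have hP0 : ¬P 0 := by simp [P]
  have hPn : ¬P (n + 1) := by
    rintro ⟨k, -, hk⟩
    have := (b k).isLt
    omega
  have hmain : Tplus (![2, -1, 2] : Fin 3 → ZMod r) (updSet w S 0) +
      Tplus (![2, -1, 2] : Fin 3 → ZMod r) (updSet w S 2) -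
      2 * Tplus (![2, -1, 2] : Fin 3 → ZMod r) (updSet w S 1) = 2 * (q : ZMod r) := by
    have hsum := Finset.sum_congr (rfl : Finset.range (n + 1) = Finset.range (n + 1))
      (fun j _ => stepWeight_combination (r := r) (P j) (P (j + 1)) (padWord w j)
        (padWord w (j + 1)))
    rw [Finset.sum_sub_distrib, Finset.sum_add_distrib, Finset.sum_add_distrib,
      ← Finset.mul_sum, ← Finset.mul_sum, ← Finset.mul_sum,
      Finset.sum_range_sub (fun j => if P j then (1 : ZMod r) else 0), Finset.sum_boole,
      card_starts_of_separated a b hab hsep P (fun _ => Iff.rfl), if_neg hP0, if_neg hPn] at hsum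
    simp only [Tplus_eq_sum, hpad]
    linear_combination hsum
  refine ⟨hmain, fun hmono => ?_⟩
  rw [← hmain, hmono 0 1, hmono 2 1]
  ring
end

section
/- For every natural number n ≥ 1 and every even integer r ≥ 2, there exists an r-colouring c : [3]^n → Fin r such that there is no monochromatic combinatorial line (with respect to c) whose wildcard set can be written as a union of fewer than r − 1 intervals of [n]. -/
/-- The letters of a word, shifted by one position and extended by `0` on both sides. -/
def padded {n : ℕ} (f : Fin n → ℤ) : ℕ → ℤ
  | 0 => 0
  | k + 1 => if h : k < n then f ⟨k, h⟩ else 0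

/-- The sum of the squared differences of consecutive entries of a padded word. -/
def energy {n : ℕ} (f : Fin n → ℤ) : ℤ :=
  ∑ k ∈ Finset.range (n + 1), (padded f (k + 1) - padded f k) ^ 2

theorem padded_add_mul {n : ℕ} (a x : Fin n → ℤ) (t : ℤ) (k : ℕ) :
    padded (fun j => a j + t * x j) k = padded a k + t * padded x k := by
  cases k with
  | zero => simp [padded]
  | succ k => by_cases h : k < n <;> simp [padded, h]

/-- The energy is quadratic, so its second difference in the direction `x` is `2 * energy x`. -/
theorem energy_second_difference {n : ℕ} (a x : Fin n → ℤ) :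
    energy (fun j => a j + 0 * x j) - 2 * energy (fun j => a j + 1 * x j)
      + energy (fun j => a j + 2 * x j) = 2 * energy x := by
  unfold energy
  simp only [padded_add_mul, Finset.mul_sum]
  rw [← Finset.sum_sub_distrib, ← Finset.sum_add_distrib]
  refine Finset.sum_congr rfl fun k _ => ?_
  ring

/-- The positions at which a padded word steps up from `0` to `1`. -/
def upSteps {n : ℕ} (x : Fin n → ℤ) : Finset ℕ :=
  (Finset.range (n + 1)).filter fun k => padded x k = 0 ∧ padded x (k + 1) = 1

theorem padded_eq_zero_or_one {n : ℕ} {x : Fin n → ℤ} (hx : ∀ j, x j = 0 ∨ x j = 1) (k : ℕ) :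
    padded x k = 0 ∨ padded x k = 1 := by
  cases k with
  | zero => simp [padded]
  | succ k =>
    by_cases h : k < n
    · simpa [padded, h] using hx ⟨k, h⟩
    · simp [padded, h]

theorem energy_eq_two_mul_card_upSteps {n : ℕ} {x : Fin n → ℤ}
    (hx : ∀ j, x j = 0 ∨ x j = 1) : energy x = 2 * ((upSteps x).card : ℤ) := by
  have htel : ∑ k ∈ Finset.range (n + 1), (padded x (k + 1) - padded x k) = 0 := by
    rw [Finset.sum_range_sub]
    simp [padded]
  have hcard : ((upSteps x).card : ℤ) = ∑ k ∈ Finset.range (n + 1),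
      if padded x k = 0 ∧ padded x (k + 1) = 1 then (1 : ℤ) else 0 := by
    simp [upSteps]
  rw [hcard, ← add_zero (energy x)]
  nth_rw 1 [← htel]
  rw [energy, Finset.mul_sum, ← Finset.sum_add_distrib]
  refine Finset.sum_congr rfl fun k _ => ?_
  rcases padded_eq_zero_or_one hx k with h | h <;>
    rcases padded_eq_zero_or_one hx (k + 1) with h' | h' <;> simp [h, h']

theorem upSteps_nonempty {n : ℕ} {x : Fin n → ℤ} (hx : ∀ j, x j = 0 ∨ x j = 1)
    {j : Fin n} (hj : x j = 1) : (upSteps x).Nonempty := by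
  by_contra hU
  rw [Finset.not_nonempty_iff_eq_empty] at hU
  have hzero : ∀ k, k ≤ n → padded x k = 0 := by
    intro k
    induction k with
    | zero => simp [padded]
    | succ k ih =>
      intro hk
      refine (padded_eq_zero_or_one hx (k + 1)).resolve_right fun h => ?_
      have hmem : k ∈ upSteps x := by
        simp only [upSteps, Finset.mem_filter, Finset.mem_range]
        exact ⟨by omega, ih (by omega), h⟩
      simp [hU] at hmem
  have h := hzero (j + 1) j.isLt
  simp [padded, hj] at h

open Classical in
/-- Every up-step of the indicator of a union of intervals is a left endpoint. -/
theorem card_upSteps_indicator_le {n q : ℕ} {S : Set (Fin n)} (hS : UnionOfIntervals q S) :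
    (upSteps fun j => if j ∈ S then (1 : ℤ) else 0).card ≤ q := by
  obtain ⟨I, hI⟩ := hS
  have hsub : (upSteps fun j => if j ∈ S then (1 : ℤ) else 0) ⊆
      Finset.univ.image fun t => ((I t).1 : ℕ) := by
    intro k hk
    simp only [upSteps, Finset.mem_filter, Finset.mem_range] at hk
    obtain ⟨-, h0, h1⟩ := hk
    have hkn : k < n := by
      by_contra h
      simp [padded, h] at h1
    have hkS : (⟨k, hkn⟩ : Fin n) ∈ S := by
      by_contra h
      simp [padded, hkn, h] at h1
    obtain ⟨t, ht⟩ := Set.mem_iUnion.mp (hI ▸ hkS)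
    refine Finset.mem_image.mpr ⟨t, Finset.mem_univ t, ?_⟩
    obtain ⟨hl, hr⟩ := ht
    rw [Fin.le_def] at hl hr
    simp only at hl hr
    by_contra hne
    cases k with
    | zero => omega
    | succ k =>
      have hk' : k < n := by omega
      have hmem : (⟨k, hk'⟩ : Fin n) ∈ S := by
        rw [hI]
        refine Set.mem_iUnion.mpr ⟨t, ?_, ?_⟩ <;> rw [Fin.le_def] <;> simp only <;> omega
      simp [padded, hk', hmem] at h0
  calc _ ≤ _ := Finset.card_le_card hsub
    _ ≤ _ := Finset.card_image_le
    _ = q := by simp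

/-- For every `n ≥ 1` and every even `r ≥ 2` there is an `r`-colouring of `[3]^n`
containing no monochromatic combinatorial line whose wildcard set is the union of
fewer than `r - 1` intervals. -/
theorem stmt5 (n r : ℕ) (hn : 1 ≤ n) (hr : 2 ≤ r) (heven : Even r) :
    ∃ c : (Fin n → Fin 3) → Fin r,
      ¬ ∃ (w : Fin n → Fin 3) (S : Set (Fin n)) (q : ℕ),
        S.Nonempty ∧ q < r - 1 ∧ UnionOfIntervals q S ∧
        ∀ i j : Fin 3, c (updSet w S i) = c (updSet w S j) := by
  classical
  have hpos : (0 : ℤ) < (r - 1 : ℕ) := by omega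
  let T : (Fin n → Fin 3) → ℤ := fun w => energy fun j => ((w j : ℕ) : ℤ)
  refine ⟨fun w => ⟨(T w % (r - 1 : ℕ)).toNat, ?_⟩, ?_⟩
  · have := Int.emod_lt_of_pos (T w) hpos
    omega
  rintro ⟨w, S, q, ⟨s, hs⟩, hq, hS, hc⟩
  have hmod : ∀ i j, T (updSet w S i) ≡ T (updSet w S j) [ZMOD (r - 1 : ℕ)] := by
    intro i j
    have h := Fin.mk.inj_iff.mp (hc i j)
    have hi := Int.emod_nonneg (T (updSet w S i)) hpos.ne'
    have hj := Int.emod_nonneg (T (updSet w S j)) hpos.ne'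
    unfold Int.ModEq
    omega
  let a : Fin n → ℤ := fun j => if j ∈ S then 0 else ((w j : ℕ) : ℤ)
  let x : Fin n → ℤ := fun j => if j ∈ S then 1 else 0
  have hx : ∀ j, x j = 0 ∨ x j = 1 := fun j => by
    by_cases h : j ∈ S <;> simp [x, h]
  have hT : ∀ i : Fin 3, T (updSet w S i) = energy fun j => a j + ((i : ℕ) : ℤ) * x j := by
    intro i
    refine congrArg energy (funext fun j => ?_)
    by_cases h : j ∈ S <;> simp [updSet, a, x, h]
  have hdiff : T (updSet w S 0) - 2 * T (updSet w S 1) + T (updSet w S 2) = 2 * energy x := by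
    rw [hT, hT, hT]
    exact energy_second_difference a x
  rw [energy_eq_two_mul_card_upSteps hx] at hdiff
  have hdvd : ((r - 1 : ℕ) : ℤ) ∣ ((4 * (upSteps x).card : ℕ) : ℤ) := by
    have h := dvd_add (hmod 1 0).dvd (hmod 1 2).dvd
    have heq : ((4 * (upSteps x).card : ℕ) : ℤ) =
        T (updSet w S 0) - T (updSet w S 1) + (T (updSet w S 2) - T (updSet w S 1)) := by
      push_cast
      linarith
    exact heq ▸ h
  have hcop : Nat.Coprime (r - 1) 4 := by
    have hodd : Odd (r - 1) := Nat.Even.sub_odd (by omega) heven odd_one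
    exact Nat.Coprime.pow_right 2 hodd.coprime_two_right
  have hle := Nat.le_of_dvd
    (Finset.card_pos.mpr (upSteps_nonempty hx (j := s) (by simp [x, hs])))
    (hcop.dvd_of_dvd_mul_left (Int.natCast_dvd_natCast.mp hdvd))
  have hup : (upSteps x).card ≤ q := card_upSteps_indicator_le hS
  omega
end

section
/- For every r ≥ 1 there exists a natural number N such that for all n ≥ N, every r-colouring c : [3]^n → Fin r contains a monochromatic combinatorial line whose wildcard set can be written as a union of at most r intervals of [n]. -/
namespace Combinatorics.Subspace

/-- The wildcard set of every coordinate of the subspace is an interval. -/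
def HasIntervalWildcards {η α ι : Type*} [Preorder ι] (l : Subspace η α ι) : Prop :=
  ∃ a b : η → ι, ∀ i e, l.idxFun i = Sum.inr e ↔ a e ≤ i ∧ i ≤ b e

end Combinatorics.Subspace

open Combinatorics

/-- Among the words `0 ⋯ 0 1 ⋯ 1` of length at least the number of colours, two have the same
colour, which yields an interval whose letters `0` and `1` are not distinguished. -/
theorem exists_interval_zero_eq_one {κ : Type*} [Fintype κ] {p : ℕ} (hp : Fintype.card κ ≤ p)
    (c : (Fin p → Fin 3) → κ) :
    ∃ (w : Fin p → Fin 3) (a b : Fin p), a ≤ b ∧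
      c (fun j => if a ≤ j ∧ j ≤ b then 0 else w j) =
        c (fun j => if a ≤ j ∧ j ≤ b then 1 else w j) := by
  obtain ⟨s, t, hst, h⟩ : ∃ s t : Fin (p + 1), s < t ∧
      c (fun j => if (j : ℕ) < s then 0 else 1) = c (fun j => if (j : ℕ) < t then 0 else 1) := by
    obtain ⟨s, t, hne, h⟩ := Fintype.exists_ne_map_eq_of_card_lt
      (fun s : Fin (p + 1) => c (fun j => if (j : ℕ) < s then 0 else 1))
      (by simpa using Nat.lt_succ_of_le hp)
    rcases lt_or_gt_of_ne hne with hlt | hlt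
    · exact ⟨s, t, hlt, h⟩
    · exact ⟨t, s, hlt, h.symm⟩
  have hst' : (s : ℕ) < t := hst
  have ht := t.isLt
  refine ⟨fun j => if (j : ℕ) < s then 0 else 1, ⟨s, by omega⟩, ⟨t - 1, by omega⟩, ?_, ?_⟩
  · simp only [Fin.mk_le_mk]
    omega
  · refine Eq.trans (congrArg c ?_) (h.symm.trans (congrArg c ?_)) <;>
    · funext j
      simp only [Fin.le_def]
      split_ifs <;> first | rfl | omega

/-- For any number of dimensions and colours, every colouring of a sufficiently long cube over
`Fin 3` admits a subspace with interval wildcard sets on which the colour of a point depends only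
on the coordinates at which the letter `2` occurs. -/
theorem exists_subspace_hasIntervalWildcards (k : ℕ) : ∀ (κ : Type) [Fintype κ],
    ∃ N : ℕ, ∀ n ≥ N, ∀ c : (Fin n → Fin 3) → κ,
      ∃ l : Subspace (Fin k) (Fin 3) (Fin n), l.HasIntervalWildcards ∧
        ∀ x y : Fin k → Fin 3, (∀ e, x e = 2 ↔ y e = 2) → c (l x) = c (l y) := by
  classical
  induction k with
  | zero =>
    intro κ _
    refine ⟨0, fun n _ c => ⟨⟨fun _ => Sum.inl 0, fun e => e.elim0⟩,
      ⟨fun e => e.elim0, fun e => e.elim0, fun _ e => e.elim0⟩, fun x y _ => ?_⟩⟩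
    rw [Subsingleton.elim x y]
  | succ k ih =>
    intro κ _
    obtain ⟨m, hm⟩ := ih (Fin 3 → κ)
    refine ⟨m + Fintype.card ((Fin m → Fin 3) → κ), fun n hn c => ?_⟩
    obtain ⟨p, rfl⟩ := Nat.exists_eq_add_of_le ((Nat.le_add_right _ _).trans hn)
    obtain ⟨w, a, b, hab, h⟩ := exists_interval_zero_eq_one (Nat.le_of_add_le_add_left hn)
      (fun v u => c (Fin.append u v))
    let v : Fin 3 → Fin p → Fin 3 := fun t j => if a ≤ j ∧ j ≤ b then t else w j
    have hv : ∀ (s t : Fin 3) (u : Fin m → Fin 3), (s = 2 ↔ t = 2) →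
        c (Fin.append u (v s)) = c (Fin.append u (v t)) := by
      intro s t u hst
      have hu : c (Fin.append u (v 0)) = c (Fin.append u (v 1)) := congrFun h u
      fin_cases s <;> fin_cases t <;> first | rfl | exact hu | exact hu.symm | simp at hst
    obtain ⟨l, ⟨a', b', hI⟩, hl⟩ := hm m le_rfl (fun u t => c (Fin.append u (v t)))
    let L : Subspace (Fin (k + 1)) (Fin 3) (Fin (m + p)) :=
      { idxFun := Fin.addCases (fun i => (l.idxFun i).map id Fin.castSucc)
          (fun j => if a ≤ j ∧ j ≤ b then Sum.inr (Fin.last k) else Sum.inl (w j))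
        proper := by
          intro e
          induction e using Fin.lastCases with
          | last => exact ⟨Fin.natAdd m a, by simp [hab]⟩
          | cast e =>
            obtain ⟨i, hi⟩ := l.proper e
            exact ⟨Fin.castAdd p i, by simp [hi]⟩ }
    have hL : ∀ x : Fin (k + 1) → Fin 3,
        L x = Fin.append (l fun e => x e.castSucc) (v (x (Fin.last k))) := by
      intro x
      funext i
      induction i using Fin.addCases with
      | left i =>
        cases hi : l.idxFun i <;> simp [L, Subspace.apply_def, hi]
      | right j =>
        by_cases hj : a ≤ j ∧ j ≤ b <;> simp [L, Subspace.apply_def, v, hj]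
    refine ⟨L, ⟨Fin.lastCases (Fin.natAdd m a) (fun e => Fin.castAdd p (a' e)),
      Fin.lastCases (Fin.natAdd m b) (fun e => Fin.castAdd p (b' e)), ?_⟩, ?_⟩
    · intro i e
      induction i using Fin.addCases with
      | left i =>
        have hi : L.idxFun (Fin.castAdd p i) = (l.idxFun i).map id Fin.castSucc := by simp [L]
        rw [hi]
        induction e using Fin.lastCases with
        | last =>
          have := i.isLt
          simp only [Fin.lastCases_last, Fin.le_def, Fin.val_castAdd, Fin.val_natAdd]
          refine iff_of_false (fun h => ?_) (by omega)
          cases hli : l.idxFun i with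
          | inl d => simp [hli] at h
          | inr d =>
            simp only [hli, Sum.map_inr, Sum.inr.injEq] at h
            exact (Fin.castSucc_lt_last d).ne h
        | cast e =>
          simp only [Fin.lastCases_castSucc, Fin.le_def, Fin.val_castAdd]
          refine Iff.trans ?_ (hI i e)
          cases l.idxFun i <;> simp
      | right j =>
        have hj : L.idxFun (Fin.natAdd m j) =
            if a ≤ j ∧ j ≤ b then Sum.inr (Fin.last k) else Sum.inl (w j) := by simp [L]
        rw [hj]
        induction e using Fin.lastCases with
        | last =>
          simp only [Fin.lastCases_last, Fin.le_def, Fin.val_natAdd, add_le_add_iff_left]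
          split_ifs with h
          · simp only [h, and_self]
          · simpa only [reduceCtorEq, false_iff] using h
        | cast e =>
          have := (b' e).isLt
          simp only [Fin.lastCases_castSucc, Fin.le_def, Fin.val_castAdd, Fin.val_natAdd]
          refine iff_of_false (fun h => ?_) (by omega)
          split_ifs at h
          exact (Fin.castSucc_lt_last e).ne' (Sum.inr.inj h)
    · intro x y hxy
      rw [hL, hL, hv _ _ _ (hxy (Fin.last k))]
      exact congrFun (hl _ _ fun e => hxy e.castSucc) _

/-- For every `r ≥ 1` there is an `N` such that for all `n ≥ N`, every `r`-colouring of
`[3]^n` contains a monochromatic combinatorial line whose wildcard set is the union of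
at most `r` intervals. -/
theorem stmt7 (r : ℕ) (hr : 1 ≤ r) :
    ∃ N : ℕ, ∀ n ≥ N, ∀ c : (Fin n → Fin 3) → Fin r,
      ∃ (w : Fin n → Fin 3) (S : Set (Fin n)),
        S.Nonempty ∧ UnionOfIntervals r S ∧
        ∀ i j : Fin 3, c (updSet w S i) = c (updSet w S j) := by
  obtain ⟨N, hN⟩ := exists_subspace_hasIntervalWildcards r (Fin r)
  refine ⟨N, fun n hn c => ?_⟩
  obtain ⟨l, ⟨a, b, hI⟩, hl⟩ := hN n hn c
  let y : ℕ → Fin r → Fin 3 := fun s e => if (e : ℕ) < s then 2 else 0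
  obtain ⟨s, t, hst, htr, h⟩ : ∃ s t : ℕ, s < t ∧ t ≤ r ∧ c (l (y s)) = c (l (y t)) := by
    obtain ⟨s, t, hne, h⟩ := Fintype.exists_ne_map_eq_of_card_lt
      (fun s : Fin (r + 1) => c (l (y s))) (by simp)
    rcases lt_or_gt_of_ne hne with hlt | hlt
    · exact ⟨s, t, hlt, Nat.le_of_lt_succ t.isLt, h⟩
    · exact ⟨t, s, hlt, Nat.le_of_lt_succ s.isLt, h.symm⟩
  let e₀ : Fin r := ⟨s, by omega⟩
  let z : Fin 3 → Fin r → Fin 3 := fun i e => if s ≤ (e : ℕ) ∧ (e : ℕ) < t then i else y s e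
  let S : Set (Fin n) := {j | ∃ e : Fin r, (s ≤ (e : ℕ) ∧ (e : ℕ) < t) ∧ l.idxFun j = Sum.inr e}
  have hz : ∀ i, updSet (l (y s)) S i = l (z i) := by
    intro i
    funext j
    cases hj : l.idxFun j with
    | inl d => simp [updSet, S, Subspace.apply_def, hj]
    | inr e => simp [updSet, S, z, Subspace.apply_def, hj]
  have hc : ∀ i, c (updSet (l (y s)) S i) = c (l (y s)) := by
    intro i
    rw [hz]
    by_cases hi : i = 2
    · rw [h]
      congr 2
      funext e
      simp only [z, y, hi]
      split_ifs <;> first | rfl | omega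
    · apply hl
      intro e
      simp only [z, y]
      split_ifs <;> omega
  refine ⟨l (y s), S, ?_, ?_, fun i j => (hc i).trans (hc j).symm⟩
  · obtain ⟨j, hj⟩ := l.proper e₀
    exact ⟨j, e₀, ⟨le_rfl, hst⟩, hj⟩
  · refine ⟨fun e => if s ≤ (e : ℕ) ∧ (e : ℕ) < t then (a e, b e) else (a e₀, b e₀), ?_⟩
    ext j
    simp only [S, Set.mem_ofPred_eq, Set.mem_iUnion, Set.mem_Icc]
    constructor
    · rintro ⟨e, he, hj⟩
      exact ⟨e, by simpa [he] using (hI j e).1 hj⟩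
    · rintro ⟨e, hj⟩
      by_cases he : s ≤ (e : ℕ) ∧ (e : ℕ) < t
      · rw [if_pos he] at hj
        exact ⟨e, he, (hI j e).2 hj⟩
      · rw [if_neg he] at hj
        exact ⟨e₀, ⟨le_rfl, hst⟩, (hI j e₀).2 hj⟩
end

section
/- For every m ≥ 2 and r ≥ 1 there exists a natural number N such that for all n ≥ N, every r-colouring c : [m]^n → Fin r contains a monochromatic combinatorial line whose wildcard set can be written as a union of at most HJ(m−1, r) intervals of [n], where HJ(m−1, r) denotes the Hales–Jewett number, i.e. the least dimension d such that every r-colouring of [m−1]^d contains a monochromatic combinatorial line. -/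
/-- Every `r`-colouring of `[m]^n` contains a monochromatic combinatorial line. -/
def hasMonoLine (m n r : ℕ) : Prop :=
  ∀ c : (Fin n → Fin m) → Fin r,
    ∃ (w : Fin n → Fin m) (S : Set (Fin n)),
      S.Nonempty ∧ ∀ i j : Fin m, c (updSet w S i) = c (updSet w S j)

/-- The Hales–Jewett number `HJ(m, r)`: the least dimension `n` such that every
`r`-colouring of `[m]^n` contains a monochromatic combinatorial line. -/
noncomputable def HJ (m r : ℕ) : ℕ := sInf {n | hasMonoLine m n r}

/-- The map collapsing the letter `a` to the letter `b` and fixing all other letters. -/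
def collapse {α : Type*} [DecidableEq α] (a b : α) (z : α) : α := if z = a then b else z

/-- Shelah's lemma: in high dimension every finite colouring admits a `d`-dimensional combinatorial
subspace, all of whose wildcard sets are intervals, on which the colouring does not distinguish
the letters `a` and `b`. -/
theorem exists_subspace_insensitive {α : Type} [Finite α] [DecidableEq α] (a b : α) (d : ℕ) :
    ∀ (κ : Type) [Finite κ], ∃ N : ℕ, ∀ n ≥ N, ∀ C : (Fin n → α) → κ,
      ∃ l : Combinatorics.Subspace (Fin d) α (Fin n),
        (∀ e, ∃ u v : Fin n, ∀ i, l.idxFun i = Sum.inr e ↔ u ≤ i ∧ i ≤ v) ∧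
        ∀ x, C (l x) = C (l (collapse a b ∘ x)) := by
  induction d with
  | zero =>
    intro κ _
    refine ⟨0, fun n _ C => ⟨⟨fun _ => Sum.inl a, fun e => e.elim0⟩, fun e => e.elim0, fun x => ?_⟩⟩
    rw [Subsingleton.elim (collapse a b ∘ x) x]
  | succ d ih =>
    intro κ _
    obtain ⟨L, hL⟩ : ∃ L, L = Nat.card ((Fin d → α) → κ) := ⟨_, rfl⟩
    obtain ⟨N, hN⟩ := ih ((Fin L → α) → κ)
    refine ⟨L + N, fun n hn C => ?_⟩
    obtain ⟨k, rfl⟩ := Nat.exists_eq_add_of_le (le_trans (Nat.le_add_right L N) hn)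
    obtain ⟨l', hint, hinv⟩ := hN k (by omega) fun y u => C (Fin.append u y)
    let step : ℕ → Fin L → α := fun t j => if (j : ℕ) < t then b else a
    obtain ⟨s, t, hst, htL, hf⟩ : ∃ s t : ℕ, s < t ∧ t ≤ L ∧ ∀ x : Fin d → α,
        C (Fin.append (step s) (l' x)) = C (Fin.append (step t) (l' x)) := by
      let f : Fin (L + 1) → ((Fin d → α) → κ) := fun t x => C (Fin.append (step t) (l' x))
      have hni : ¬ Function.Injective f := fun h => by
        have := Nat.card_le_card_of_injective f h
        rw [← hL, Nat.card_fin] at this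
        omega
      obtain ⟨s, t, he, hne⟩ := Function.not_injective_iff.1 hni
      rcases lt_or_gt_of_ne hne with h | h
      · exact ⟨s, t, h, Nat.le_of_lt_succ t.2, congrFun he⟩
      · exact ⟨t, s, h, Nat.le_of_lt_succ s.2, congrFun he.symm⟩
    let block : α → Fin L → α := fun z j =>
      if (j : ℕ) < s then b else if (j : ℕ) < t then z else a
    have hba : block a = step s := by
      funext j
      simp only [block, step]
      split_ifs <;> rfl
    have hbb : block b = step t := by
      funext j
      simp only [block, step]
      split_ifs <;> first | rfl | omega
    let idx : Fin (L + k) → α ⊕ Fin (d + 1) := Fin.append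
      (fun j => if (j : ℕ) < s then Sum.inl b else if (j : ℕ) < t then Sum.inr 0 else Sum.inl a)
      (fun j => (l'.idxFun j).map id Fin.succ)
    have hidx : ∀ e, ∃ u v : Fin (L + k), u ≤ v ∧ ∀ i, idx i = Sum.inr e ↔ u ≤ i ∧ i ≤ v := by
      refine Fin.cases ?_ fun e => ?_
      · refine ⟨⟨s, by omega⟩, ⟨t - 1, by omega⟩, Fin.mk_le_mk.2 (by omega), fun i => ?_⟩
        induction i using Fin.addCases with
        | left j =>
          simp only [idx, Fin.append_left, Fin.le_def, Fin.val_castAdd]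
          split_ifs <;> simp <;> omega
        | right j =>
          simp only [idx, Fin.append_right, Fin.le_def, Fin.val_natAdd]
          have : ¬ L + (j : ℕ) ≤ t - 1 := by omega
          cases l'.idxFun j <;> simp [this, Fin.succ_ne_zero]
      · obtain ⟨u, v, huv⟩ := hint e
        obtain ⟨i₀, hi₀⟩ := l'.proper e
        have h₀ := (huv i₀).1 hi₀
        refine ⟨Fin.natAdd L u, Fin.natAdd L v, ?_, fun i => ?_⟩
        · simpa using h₀.1.trans h₀.2
        · induction i using Fin.addCases with
          | left j =>
            simp only [idx, Fin.append_left, Fin.le_def, Fin.val_castAdd, Fin.val_natAdd]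
            have : ¬ L + (u : ℕ) ≤ j := by omega
            split_ifs <;> simp [this, (Fin.succ_ne_zero _).symm]
          | right j =>
            have := huv j
            simp only [idx, Fin.append_right, Fin.natAdd_le_natAdd_iff]
            rw [← this]
            cases l'.idxFun j <;> simp
    let l : Combinatorics.Subspace (Fin (d + 1)) α (Fin (L + k)) :=
      ⟨idx, fun e => (hidx e).elim fun u ⟨v, huv, h⟩ => ⟨u, (h u).2 ⟨le_rfl, huv⟩⟩⟩
    have hl : ∀ x, l x = Fin.append (block (x 0)) (l' (Fin.tail x)) := by
      intro x
      funext i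
      induction i using Fin.addCases with
      | left j =>
        simp only [l, idx, block, Combinatorics.Subspace.coe_apply, Fin.append_left]
        split_ifs <;> rfl
      | right j =>
        simp only [l, idx, Combinatorics.Subspace.coe_apply, Fin.append_right]
        cases l'.idxFun j <;> rfl
    refine ⟨l, fun e => (hidx e).imp fun u h => h.imp fun v h => h.2, fun x => ?_⟩
    have htail : Fin.tail (collapse a b ∘ x) = collapse a b ∘ Fin.tail x := rfl
    rw [hl, hl, htail, congrFun (hinv (Fin.tail x)) (block (x 0)), Function.comp_apply]
    by_cases h : x 0 = a
    · rw [h, collapse, if_pos rfl, hba, hbb, hf]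
    · rw [collapse, if_neg h]

/-- The Hales–Jewett theorem, for `hasMonoLine`. -/
theorem exists_hasMonoLine {m : ℕ} (z : Fin m) (r : ℕ) : ∃ n, hasMonoLine m n r := by
  obtain ⟨ι, _, h⟩ := Combinatorics.Line.exists_mono_in_high_dimension (Fin m) (Fin r)
  let e := Fintype.equivFin ι
  refine ⟨Fintype.card ι, fun c => ?_⟩
  obtain ⟨l, k, hl⟩ := h fun x => c (x ∘ e.symm)
  obtain ⟨i₀, hi₀⟩ := l.proper
  refine ⟨l z ∘ e.symm, {j | l.idxFun (e.symm j) = none}, ⟨e i₀, by simpa using hi₀⟩, ?_⟩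
  have key : ∀ i, updSet (l z ∘ e.symm) {j | l.idxFun (e.symm j) = none} i = l i ∘ e.symm := by
    intro i
    funext j
    simp only [updSet, Set.mem_ofPred_eq, Function.comp_apply, Combinatorics.Line.coe_apply]
    by_cases h : l.idxFun (e.symm j) = none
    · simp [h]
    · obtain ⟨y, hy⟩ := Option.ne_none_iff_exists'.1 h
      simp [hy]
  intro i j
  rw [key, key]
  exact (hl i).trans (hl j).symm

theorem hasMonoLine_HJ {m : ℕ} (z : Fin m) (r : ℕ) : hasMonoLine m (HJ m r) r :=
  Nat.sInf_mem (exists_hasMonoLine z r)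

/-- For every `m ≥ 2` and `r ≥ 1` there is an `N` such that for all `n ≥ N`, every
`r`-colouring of `[m]^n` contains a monochromatic combinatorial line whose wildcard
set is the union of at most `HJ(m - 1, r)` intervals. -/
theorem stmt8 (m r : ℕ) (hm : 2 ≤ m) (hr : 1 ≤ r) :
    ∃ N : ℕ, ∀ n ≥ N, ∀ c : (Fin n → Fin m) → Fin r,
      ∃ (w : Fin n → Fin m) (S : Set (Fin n)),
        S.Nonempty ∧ UnionOfIntervals (HJ (m - 1) r) S ∧
        ∀ i j : Fin m, c (updSet w S i) = c (updSet w S j) := by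
  obtain ⟨k, rfl⟩ := Nat.exists_eq_add_of_le' hm
  change ∃ N : ℕ, ∀ n ≥ N, ∀ c : (Fin n → Fin (k + 2)) → Fin r,
    ∃ (w : Fin n → Fin (k + 2)) (S : Set (Fin n)),
      S.Nonempty ∧ UnionOfIntervals (HJ (k + 1) r) S ∧
      ∀ i j : Fin (k + 2), c (updSet w S i) = c (updSet w S j)
  obtain ⟨N, hN⟩ := exists_subspace_insensitive (Fin.last (k + 1)) (Fin.last k).castSucc
    (HJ (k + 1) r) (Fin r)
  refine ⟨N, fun n hn c => ?_⟩
  obtain ⟨l, hint, hinv⟩ := hN n hn c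
  obtain ⟨w, S, ⟨e₀, he₀⟩, hmono⟩ := hasMonoLine_HJ (0 : Fin (k + 1)) r
    fun x => c (l (Fin.castSucc ∘ x))
  refine ⟨l (Fin.castSucc ∘ w), {i | ∃ e ∈ S, l.idxFun i = Sum.inr e}, ?_, ?_, ?_⟩
  · obtain ⟨i, hi⟩ := l.proper e₀
    exact ⟨i, e₀, he₀, hi⟩
  · classical
    choose u v huv using hint
    let g : Fin (HJ (k + 1) r) → Fin (HJ (k + 1) r) := fun e => if e ∈ S then e else e₀
    have hg : ∀ e, g e ∈ S := fun e => by
      by_cases h : e ∈ S <;> simp [g, h, he₀]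
    refine ⟨fun e => (u (g e), v (g e)), ?_⟩
    ext i
    simp only [Set.mem_ofPred_eq, Set.mem_iUnion, Set.mem_Icc]
    constructor
    · rintro ⟨e, he, hi⟩
      have hge : g e = e := if_pos he
      exact ⟨e, by rw [hge]; exact (huv e i).1 hi⟩
    · rintro ⟨e, he⟩
      exact ⟨g e, hg e, (huv (g e) i).2 he⟩
  · have hupd : ∀ i, updSet (l (Fin.castSucc ∘ w)) {i | ∃ e ∈ S, l.idxFun i = Sum.inr e} i =
        l (updSet (Fin.castSucc ∘ w) S i) := by
      intro i
      funext j
      simp only [updSet, Set.mem_ofPred_eq, Combinatorics.Subspace.coe_apply]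
      obtain ⟨z, hz⟩ | ⟨e, he⟩ : (∃ z, l.idxFun j = Sum.inl z) ∨ ∃ e, l.idxFun j = Sum.inr e := by
        cases l.idxFun j <;> simp
      · simp [hz]
      · have hS : (∃ e ∈ S, l.idxFun j = Sum.inr e) ↔ e ∈ S := by simp [he]
        by_cases h : e ∈ S
        · rw [if_pos (hS.2 h)]
          simp [he, updSet, h]
        · rw [if_neg (mt hS.1 h)]
          simp [he, updSet, h]
    have hcol : ∀ i : Fin (k + 2), ∃ i' : Fin (k + 1),
        collapse (Fin.last (k + 1)) (Fin.last k).castSucc i = i'.castSucc := by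
      refine Fin.lastCases ⟨Fin.last k, by simp [collapse]⟩ fun i => ⟨i, ?_⟩
      simp [collapse, (Fin.castSucc_lt_last i).ne]
    have hred : ∀ i : Fin (k + 2), ∃ i' : Fin (k + 1),
        c (l (updSet (Fin.castSucc ∘ w) S i)) = c (l (Fin.castSucc ∘ updSet w S i')) := by
      intro i
      obtain ⟨i', hi'⟩ := hcol i
      refine ⟨i', ?_⟩
      rw [hinv]
      congr 2
      funext e
      by_cases h : e ∈ S
      · simp [updSet, h, hi']
      · simp [updSet, h, collapse, (Fin.castSucc_lt_last (w e)).ne]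
    intro i j
    obtain ⟨i', hi'⟩ := hred i
    obtain ⟨j', hj'⟩ := hred j
    rw [hupd, hupd, hi', hj', hmono i' j']
end

section
/- For every r ≥ 1 there exists a natural number N such that for all n ≥ N and every r-colouring c of [3]^n, there exist a word w ∈ [3]^n and pairwise disjoint nonempty intervals S₁, ..., S_r of [n] with the following property: for every subset T ⊆ [r] and all i₁, ..., i_r ∈ [3], the word w(S₁, j'₁; ...; S_r, j'_r) defined by j'_t = 2 for t ∈ T and j'_t = i_t for t ∉ T has the same colour under c as the word w(S₁, j''₁; ...; S_r, j''_r) defined by j''_t = 3 for t ∈ T and j''_t = i_t for t ∉ T. -/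
/- A word over `[3]` of length `n` is a function `Fin n → Fin 3`
(letter `k` corresponds to index `k - 1`).
`multiUpd w Ss js` is the word `w(S₁, j₁; …; S_r, j_r)` obtained from `w` by replacing
the `p`-th letter with `js k` whenever `p ∈ Ss k` (well-defined when the `Ss k` are
pairwise disjoint). -/
open Classical in
noncomputable def multiUpd {n r : ℕ} (w : Fin n → Fin 3) (Ss : Fin r → Set (Fin n))
    (js : Fin r → Fin 3) : Fin n → Fin 3 :=
  fun p => if h : ∃ k, p ∈ Ss k then js h.choose else w p

theorem multiUpd_of_mem {n r : ℕ} (w : Fin n → Fin 3) {Ss : Fin r → Set (Fin n)}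
    (js : Fin r → Fin 3) (hS : Pairwise fun k l => Disjoint (Ss k) (Ss l))
    {p : Fin n} {k : Fin r} (hp : p ∈ Ss k) : multiUpd w Ss js p = js k := by
  have h : ∃ k, p ∈ Ss k := ⟨k, hp⟩
  have hk : h.choose = k := by
    by_contra hne
    exact Set.disjoint_left.1 (hS hne) h.choose_spec hp
  rw [multiUpd, dif_pos h, hk]

theorem multiUpd_of_notMem {n r : ℕ} (w : Fin n → Fin 3) {Ss : Fin r → Set (Fin n)}
    (js : Fin r → Fin 3) {p : Fin n} (hp : ∀ k, p ∉ Ss k) : multiUpd w Ss js p = w p := by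
  rw [multiUpd, dif_neg (by simpa using hp)]

/-- The word obtained from `u` by writing the letter `x` throughout the interval `[a, b]`. -/
def fillInterval {m : ℕ} (u : Fin m → Fin 3) (a b : Fin m) (x : Fin 3) : Fin m → Fin 3 :=
  fun p => if a ≤ p ∧ p ≤ b then x else u p

theorem pairwise_disjoint_Icc_cons {m n q : ℕ} (a₀ b₀ : Fin m) {a b : Fin q → Fin n}
    (hS : Pairwise fun k l => Disjoint (Set.Icc (a k) (b k)) (Set.Icc (a l) (b l))) :
    Pairwise fun k l : Fin (q + 1) => Disjoint
      (Set.Icc (Fin.cons (α := fun _ => Fin (m + n)) (Fin.castAdd n a₀)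
          (fun i => Fin.natAdd m (a i)) k)
        (Fin.cons (α := fun _ => Fin (m + n)) (Fin.castAdd n b₀)
          (fun i => Fin.natAdd m (b i)) k))
      (Set.Icc (Fin.cons (α := fun _ => Fin (m + n)) (Fin.castAdd n a₀)
          (fun i => Fin.natAdd m (a i)) l)
        (Fin.cons (α := fun _ => Fin (m + n)) (Fin.castAdd n b₀)
          (fun i => Fin.natAdd m (b i)) l)) := by
  intro k l hkl
  rw [Set.disjoint_left]
  intro p
  induction k using Fin.cases with
  | zero =>
    induction l using Fin.cases with
    | zero => exact absurd rfl hkl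
    | succ l =>
      simp only [Fin.cons_zero, Fin.cons_succ, Set.mem_Icc, Fin.le_def, Fin.val_castAdd,
        Fin.val_natAdd]
      omega
  | succ k =>
    induction l using Fin.cases with
    | zero =>
      simp only [Fin.cons_zero, Fin.cons_succ, Set.mem_Icc, Fin.le_def, Fin.val_castAdd,
        Fin.val_natAdd]
      omega
    | succ l =>
      have h := Set.disjoint_left.1 (hS (fun h => hkl (congrArg Fin.succ h) : k ≠ l))
      induction p using Fin.addCases with
      | left p =>
        simp only [Fin.cons_succ, Set.mem_Icc, Fin.le_def, Fin.val_castAdd, Fin.val_natAdd]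
        omega
      | right p => simpa using @h p

theorem multiUpd_append {m n q : ℕ} (u : Fin m → Fin 3) (v : Fin n → Fin 3) (a₀ b₀ : Fin m)
    {a b : Fin q → Fin n}
    (hS : Pairwise fun k l => Disjoint (Set.Icc (a k) (b k)) (Set.Icc (a l) (b l)))
    (js : Fin (q + 1) → Fin 3) :
    multiUpd (Fin.append u v)
      (fun k => Set.Icc (Fin.cons (α := fun _ => Fin (m + n)) (Fin.castAdd n a₀)
          (fun i => Fin.natAdd m (a i)) k)
        (Fin.cons (α := fun _ => Fin (m + n)) (Fin.castAdd n b₀)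
          (fun i => Fin.natAdd m (b i)) k)) js =
      Fin.append (fillInterval u a₀ b₀ (js 0))
        (multiUpd v (fun k => Set.Icc (a k) (b k)) (fun k => js k.succ)) := by
  have hS' := pairwise_disjoint_Icc_cons a₀ b₀ hS
  funext p
  induction p using Fin.addCases with
  | left p =>
    rw [Fin.append_left, fillInterval]
    split_ifs with hp
    · exact multiUpd_of_mem _ _ hS' (k := 0) hp
    · rw [multiUpd_of_notMem, Fin.append_left]
      intro k
      induction k using Fin.cases with
      | zero => exact hp
      | succ k =>
        simp only [Fin.cons_succ, Set.mem_Icc, Fin.le_def, Fin.val_castAdd, Fin.val_natAdd]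
        omega
  | right p =>
    rw [Fin.append_right]
    by_cases hp : ∃ k, p ∈ Set.Icc (a k) (b k)
    · obtain ⟨k, hk⟩ := hp
      rw [multiUpd_of_mem v _ hS hk]
      exact multiUpd_of_mem _ _ hS' (k := k.succ) (by simpa using hk)
    · push Not at hp
      rw [multiUpd_of_notMem v _ hp, multiUpd_of_notMem, Fin.append_right]
      intro k
      induction k using Fin.cases with
      | zero =>
        simp only [Fin.cons_zero, Set.mem_Icc, Fin.le_def, Fin.val_castAdd, Fin.val_natAdd]
        omega
      | succ k => simpa using hp k

/-- In a word as long as the number of colours, some interval can be switched between the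
letters `1` and `2` without changing the colour. -/
theorem exists_fillInterval_eq {K : Type} [Fintype K] (f : (Fin (Fintype.card K) → Fin 3) → K) :
    ∃ (u : Fin (Fintype.card K) → Fin 3) (a b : Fin (Fintype.card K)), a ≤ b ∧
      f (fillInterval u a b 1) = f (fillInterval u a b 2) := by
  let t : ℕ → Fin (Fintype.card K) → Fin 3 := fun j p => if (p : ℕ) < j then 1 else 2
  obtain ⟨i, j, hij, h⟩ : ∃ i j : Fin (Fintype.card K + 1), i < j ∧ f (t i) = f (t j) := by
    obtain ⟨i, j, hne, h⟩ := Fintype.exists_ne_map_eq_of_card_lt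
      (fun i : Fin (Fintype.card K + 1) => f (t i)) (by simp)
    rcases lt_or_gt_of_ne hne with hlt | hlt
    · exact ⟨i, j, hlt, h⟩
    · exact ⟨j, i, hlt, h.symm⟩
  have hij' : (i : ℕ) < j := hij
  refine ⟨t i, ⟨i, by omega⟩, ⟨j - 1, by omega⟩, by rw [Fin.mk_le_mk]; omega, ?_⟩
  convert h.symm using 2 <;> funext p <;> simp only [fillInterval, t, Fin.le_def] <;>
    split_ifs <;> first | rfl | omega

theorem exists_intervals_color_eq (q : ℕ) : ∀ (K : Type) [Finite K], ∃ N : ℕ, ∀ n ≥ N,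
    ∀ c : (Fin n → Fin 3) → K, ∃ (w : Fin n → Fin 3) (a b : Fin q → Fin n),
      (∀ k, a k ≤ b k) ∧
      (Pairwise fun k l => Disjoint (Set.Icc (a k) (b k)) (Set.Icc (a l) (b l))) ∧
      ∀ js js' : Fin q → Fin 3, (∀ k, js k = js' k ∨ js k ≠ 0 ∧ js' k ≠ 0) →
        c (multiUpd w (fun k => Set.Icc (a k) (b k)) js) =
          c (multiUpd w (fun k => Set.Icc (a k) (b k)) js') := by
  induction q with
  | zero =>
    intro K _
    refine ⟨0, fun n _ c => ⟨fun _ => 0, Fin.elim0, Fin.elim0, fun k => k.elim0,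
      fun k => k.elim0, fun js js' _ => by rw [Subsingleton.elim js js']⟩⟩
  | succ q ih =>
    intro K _
    have := Fintype.ofFinite ((Fin q → Fin 3) → K)
    let m := Fintype.card ((Fin q → Fin 3) → K)
    obtain ⟨N, hN⟩ := ih ((Fin m → Fin 3) → K)
    refine ⟨m + N, fun n hn c => ?_⟩
    obtain ⟨n, rfl⟩ := Nat.exists_eq_add_of_le (le_trans (Nat.le_add_right m N) hn)
    obtain ⟨v, a, b, hab, hS, hv⟩ := hN n (by omega) fun v u => c (Fin.append u v)
    obtain ⟨u, a₀, b₀, hab₀, hu⟩ := exists_fillInterval_eq fun u js =>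
      c (Fin.append u (multiUpd v (fun k => Set.Icc (a k) (b k)) js))
    refine ⟨Fin.append u v, Fin.cons (Fin.castAdd n a₀) (fun i => Fin.natAdd m (a i)),
      Fin.cons (Fin.castAdd n b₀) (fun i => Fin.natAdd m (b i)), ?_,
      pairwise_disjoint_Icc_cons a₀ b₀ hS, ?_⟩
    · intro k
      induction k using Fin.cases with
      | zero => exact hab₀
      | succ k => simpa using hab k
    · intro js js' h
      rw [multiUpd_append u v a₀ b₀ hS, multiUpd_append u v a₀ b₀ hS]
      refine (congrFun (hv _ _ fun k => h k.succ) _).trans ?_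
      have hu' := congrFun hu fun k => js' k.succ
      rcases h 0 with h0 | ⟨h0, h0'⟩
      · rw [h0]
      · generalize js 0 = x at h0 ⊢
        generalize js' 0 = y at h0' ⊢
        fin_cases x <;> fin_cases y <;>
          first | rfl | exact absurd rfl h0 | exact absurd rfl h0' | exact hu' | exact hu'.symm

/-- First step of Shelah's proof: for every `r ≥ 1` there is an `N` such that for all
`n ≥ N` and every `r`-colouring `c` of `[3]^n` there are a word `w` and pairwise
disjoint nonempty intervals `S₁, …, S_r` of `[n]` such that for every `T ⊆ [r]` and all
`i₁, …, i_r ∈ [3]`, the word obtained by filling `S_t` with the letter `2` for `t ∈ T`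
and with `i_t` for `t ∉ T` has the same colour as the word obtained by filling `S_t`
with the letter `3` for `t ∈ T` and with `i_t` for `t ∉ T`.  (Letters `2`, `3`
correspond to indices `1`, `2` of `Fin 3`.) -/
theorem stmt9 (r : ℕ) (hr : 1 ≤ r) :
    ∃ N : ℕ, ∀ n ≥ N, ∀ c : (Fin n → Fin 3) → Fin r,
      ∃ (w : Fin n → Fin 3) (a b : Fin r → Fin n),
        (∀ k, a k ≤ b k) ∧
        (∀ k l, k ≠ l →
          Disjoint (Set.Icc (a k) (b k)) (Set.Icc (a l) (b l))) ∧
        ∀ (T : Finset (Fin r)) (iv : Fin r → Fin 3),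
          c (multiUpd w (fun k => Set.Icc (a k) (b k))
              (fun k => if k ∈ T then (1 : Fin 3) else iv k)) =
          c (multiUpd w (fun k => Set.Icc (a k) (b k))
              (fun k => if k ∈ T then (2 : Fin 3) else iv k)) := by
  obtain ⟨N, hN⟩ := exists_intervals_color_eq r (Fin r)
  refine ⟨N, fun n hn c => ?_⟩
  obtain ⟨w, a, b, hab, hS, h⟩ := hN n hn c
  refine ⟨w, a, b, hab, fun k l hkl => hS hkl, fun T iv => h _ _ fun k => ?_⟩
  by_cases hk : k ∈ T <;> simp [hk]
end
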